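/- Let b = ρΦ ∈ C¹_♯(Y_d)^d, where ρ ∈ C¹_♯(Y_d) is nonnegative and not identically zero and Φ ∈ C¹_♯(Y_d)^d vanishes nowhere. Let (ρ_n) be a sequence in C¹_♯(Y_d) such that each ρ_n is positive everywhere, ρ ≤ ρ_n on ℝ^d, (ρ_n) converges uniformly to ρ on ℝ^d, and for each n the rotation set of b_n := ρ_n Φ is a singleton {ζ_n}. If ρ vanishes at some point of ℝ^d, then (ζ_n) converges to some ζ ∈ ℝ^d, the rotation set C_b equals the closed segment [0,ζ] := {sζ : s ∈ [0,1]}, and both 0 and ζ belong to A_b. -/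

import Mathlib

open MeasureTheory Filter Matrix

noncomputable section

/-- A function on `ℝ^d` is `ℤ^d`-periodic. -/
def ZdPeriodic {d : ℕ} {E : Type*} (f : (Fin d → ℝ) → E) : Prop :=
  ∀ (κ : Fin d → ℤ) (x : Fin d → ℝ), f (x + fun i => (κ i : ℝ)) = f x

/-- The unit cube `[0,1)^d`, a fundamental domain for the torus `Y_d = ℝ^d/ℤ^d`. -/
def unitCube (d : ℕ) : Set (Fin d → ℝ) := {x | ∀ i, x i ∈ Set.Ico (0 : ℝ) 1}

/-- `X` is the global flow of the vector field `b`: `∂X/∂t(t,x) = b(X(t,x))`, `X(0,x) = x`. -/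
def IsFlowOf {d : ℕ} (b : (Fin d → ℝ) → (Fin d → ℝ))
    (X : ℝ → (Fin d → ℝ) → (Fin d → ℝ)) : Prop :=
  ∀ x : Fin d → ℝ, X 0 x = x ∧ ∀ t : ℝ, HasDerivAt (fun s => X s x) (b (X t x)) t

/-- A measure `μ` on the torus `Y_d` (identified with a measure on `ℝ^d` carried by the unit
cube) is invariant for the flow `X`: `∫ ψ(X(t,y)) dμ = ∫ ψ dμ` for all `t` and all continuous
`ℤ^d`-periodic `ψ`. -/
def FlowInvariant {d : ℕ} (X : ℝ → (Fin d → ℝ) → (Fin d → ℝ))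
    (μ : Measure (Fin d → ℝ)) : Prop :=
  ∀ (t : ℝ) (ψ : (Fin d → ℝ) → ℝ), Continuous ψ → ZdPeriodic ψ →
    ∫ y, ψ (X t y) ∂μ = ∫ y, ψ y ∂μ

/-- Herman's rotation set `C_b = {∫ b dμ : μ invariant probability measure for the flow}`. -/
def rotationSet {d : ℕ} (b : (Fin d → ℝ) → (Fin d → ℝ))
    (X : ℝ → (Fin d → ℝ) → (Fin d → ℝ)) : Set (Fin d → ℝ) :=
  {ζ | ∃ μ : Measure (Fin d → ℝ), IsProbabilityMeasure μ ∧ μ (unitCube d)ᶜ = 0 ∧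
        FlowInvariant X μ ∧ ζ = ∫ y, b y ∂μ}

/-- The gradient of a scalar function on `ℝ^d`. -/
def grad {d : ℕ} (ψ : (Fin d → ℝ) → ℝ) (y : Fin d → ℝ) : Fin d → ℝ :=
  fun i => fderiv ℝ ψ y (Pi.single i 1)

/-- The set `A_b`: the union over `x ∈ ℝ^d` of the sets of limit points of the sequences
`(X(n,x)/n)_{n ≥ 1}`. -/
def limitPointsSet {d : ℕ} (X : ℝ → (Fin d → ℝ) → (Fin d → ℝ)) : Set (Fin d → ℝ) :=
  ⋃ x : Fin d → ℝ, {a | MapClusterPt a atTop fun n : ℕ => ((n : ℝ))⁻¹ • X (n : ℝ) x}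


section TorusFlow

open Topology
open scoped NNReal

variable {d : ℕ} {E : Type*} [NormedAddCommGroup E]

/-! ### Periodic functions -/

/-- The representative of a point of `ℝ^d` modulo `ℤ^d` in the unit cube. -/
def fractPt (x : Fin d → ℝ) : Fin d → ℝ := fun i => Int.fract (x i)

lemma fractPt_mem_unitCube (x : Fin d → ℝ) : fractPt x ∈ unitCube d :=
  fun _ => ⟨Int.fract_nonneg _, Int.fract_lt_one _⟩

lemma fractPt_mem_Icc (x : Fin d → ℝ) : fractPt x ∈ Set.Icc (0 : Fin d → ℝ) 1 :=
  ⟨fun _ => Int.fract_nonneg _, fun _ => (Int.fract_lt_one _).le⟩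

lemma measurable_fractPt : Measurable (fractPt (d := d)) :=
  measurable_pi_lambda _ fun i => measurable_fract.comp (measurable_pi_apply i)

lemma measurableSet_unitCube : MeasurableSet (unitCube d) := by
  have : unitCube d = Set.univ.pi fun _ : Fin d => Set.Ico (0 : ℝ) 1 := by
    ext x; simp [unitCube]
  rw [this]
  exact MeasurableSet.univ_pi fun _ => measurableSet_Ico

lemma fractPt_add_floor (x : Fin d → ℝ) : (fractPt x + fun i => ((⌊x i⌋ : ℤ) : ℝ)) = x :=
  funext fun i => Int.fract_add_floor (x i)

lemma periodic_fractPt {F : Type*} {f : (Fin d → ℝ) → F} (hf : ZdPeriodic f)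
    (x : Fin d → ℝ) : f (fractPt x) = f x := by
  conv_rhs => rw [← fractPt_add_floor x]
  exact (hf _ _).symm

lemma exists_bound_of_periodic {f : (Fin d → ℝ) → E} (hf : Continuous f) (hp : ZdPeriodic f) :
    ∃ C, 0 ≤ C ∧ ∀ x, ‖f x‖ ≤ C := by
  obtain ⟨C, hC⟩ := isCompact_Icc.exists_bound_of_continuousOn
    (hf.continuousOn (s := Set.Icc (0 : Fin d → ℝ) 1))
  have h : ∀ x, ‖f x‖ ≤ C := fun x => periodic_fractPt hp x ▸ hC _ (fractPt_mem_Icc x)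
  exact ⟨C, (norm_nonneg _).trans (h 0), h⟩

lemma uniformContinuous_of_periodic {f : (Fin d → ℝ) → E} (hf : Continuous f)
    (hp : ZdPeriodic f) : UniformContinuous f := by
  have hK := (isCompact_closedBall (0 : Fin d → ℝ) 2).uniformContinuousOn_of_continuous
    hf.continuousOn
  rw [Metric.uniformContinuousOn_iff] at hK
  rw [Metric.uniformContinuous_iff]
  intro ε hε
  obtain ⟨δ, hδ, h⟩ := hK ε hε
  refine ⟨min δ 1, lt_min hδ one_pos, fun {x y} hxy => ?_⟩
  set κ : Fin d → ℤ := fun i => ⌊x i⌋ with hκ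
  have hx : x = fractPt x + fun i => (κ i : ℝ) := (fractPt_add_floor x).symm
  set y' : Fin d → ℝ := y - fun i => (κ i : ℝ) with hy'
  have hy : y = y' + fun i => (κ i : ℝ) := by simp [hy']
  have hd : dist (fractPt x) y' = dist x y := by
    conv_rhs => rw [hx, hy, dist_add_right]
  have h1 : dist (fractPt x) 0 ≤ 1 := by
    refine (dist_pi_le_iff zero_le_one).2 fun i => ?_
    have := fractPt_mem_Icc x
    rw [Pi.zero_apply, Real.dist_eq, sub_zero, abs_of_nonneg (this.1 i)]
    exact this.2 i
  have h2 : dist y' 0 ≤ 2 := by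
    have := dist_triangle y' (fractPt x) 0
    rw [dist_comm y' (fractPt x), hd] at this
    have := (hxy.trans_le (min_le_right _ _)).le
    linarith
  rw [hx, hy, hp, hp]
  exact h _ (by simp only [Metric.mem_closedBall]; linarith) _ h2
    (by rw [hd]; exact hxy.trans_le (min_le_left _ _))

lemma exists_lipschitzWith_of_periodic [NormedSpace ℝ E] {f : (Fin d → ℝ) → E}
    (hf : ContDiff ℝ 1 f) (hp : ZdPeriodic f) : ∃ K, LipschitzWith K f := by
  have hper : ZdPeriodic (fderiv ℝ f) := by
    intro κ x
    rw [← fderiv_comp_add_right]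
    congr 1
    exact funext fun y => hp κ y
  obtain ⟨C, hC0, hC⟩ := exists_bound_of_periodic (hf.continuous_fderiv one_ne_zero) hper
  exact ⟨⟨C, hC0⟩, lipschitzWith_of_nnnorm_fderiv_le (hf.differentiable one_ne_zero) hC⟩

lemma ZdPeriodic.smul {f : (Fin d → ℝ) → ℝ} {g : (Fin d → ℝ) → (Fin d → ℝ)}
    (hf : ZdPeriodic f) (hg : ZdPeriodic g) : ZdPeriodic fun x => f x • g x := by
  intro κ x; simp only [hf κ x, hg κ x]

lemma integrable_of_periodic [MeasurableSpace E] [BorelSpace E] [SecondCountableTopology E]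
    {f : (Fin d → ℝ) → E} (hf : Continuous f)
    (hp : ZdPeriodic f) (μ : Measure (Fin d → ℝ)) [IsFiniteMeasure μ] : Integrable f μ := by
  obtain ⟨C, -, hC⟩ := exists_bound_of_periodic hf hp
  exact Integrable.of_bound hf.measurable.aestronglyMeasurable C (ae_of_all _ hC)

/-! ### Flows of Lipschitz vector fields -/

section Flow

variable {b b' : (Fin d → ℝ) → (Fin d → ℝ)} {X X' : ℝ → (Fin d → ℝ) → (Fin d → ℝ)} {K : ℝ≥0}

lemma IsFlowOf.reverse (hX : IsFlowOf b X) : IsFlowOf (fun y => - b y) fun t => X (-t) := by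
  refine fun x => ⟨by simpa using (hX x).1, fun t => ?_⟩
  have h := ((hX x).2 (-t)).scomp t (hasDerivAt_neg t)
  rw [neg_one_smul] at h
  exact h

lemma IsFlowOf.continuous_time (hX : IsFlowOf b X) (x : Fin d → ℝ) :
    Continuous fun t => X t x :=
  continuous_iff_continuousAt.2 fun t => ((hX x).2 t).continuousAt

lemma IsFlowOf.dist_le_of_nonneg (hX : IsFlowOf b X) (hX' : IsFlowOf b' X')
    (hb : LipschitzWith K b) {ε : ℝ} (hε : ∀ y, dist (b' y) (b y) ≤ ε)
    (x x' : Fin d → ℝ) {t : ℝ} (ht : 0 ≤ t) :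
    dist (X t x) (X' t x') ≤ gronwallBound (dist x x') K ε t := by
  have := dist_le_of_approx_trajectories_ODE (v := fun _ => b) (K := K)
    (f := fun s => X s x) (g := fun s => X' s x') (f' := fun s => b (X s x))
    (g' := fun s => b' (X' s x')) (a := 0) (b := t) (εf := 0) (εg := ε) (δ := dist x x')
    (fun _ => hb) (hX.continuous_time x).continuousOn
    (fun s _ => ((hX x).2 s).hasDerivWithinAt) (fun s _ => by simp)
    (hX'.continuous_time x').continuousOn
    (fun s _ => ((hX' x').2 s).hasDerivWithinAt) (fun s _ => hε _)
    (by simp [(hX x).1, (hX' x').1]) t ⟨ht, le_rfl⟩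
  simpa using this

lemma IsFlowOf.dist_le (hX : IsFlowOf b X) (hX' : IsFlowOf b' X')
    (hb : LipschitzWith K b) {ε : ℝ} (hε : ∀ y, dist (b' y) (b y) ≤ ε)
    (x x' : Fin d → ℝ) (t : ℝ) :
    dist (X t x) (X' t x') ≤ gronwallBound (dist x x') K ε |t| := by
  rcases le_total 0 t with ht | ht
  · rw [abs_of_nonneg ht]
    exact hX.dist_le_of_nonneg hX' hb hε x x' ht
  · rw [abs_of_nonpos ht]
    have := (IsFlowOf.reverse hX).dist_le_of_nonneg (IsFlowOf.reverse hX') hb.neg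
      (ε := ε) (by simpa using hε) x x' (neg_nonneg.2 ht)
    simpa using this

lemma IsFlowOf.continuous (hX : IsFlowOf b X) (hb : LipschitzWith K b) (t : ℝ) :
    Continuous (X t) := by
  refine (LipschitzWith.of_dist_le_mul (K := ⟨Real.exp (K * |t|), (Real.exp_pos _).le⟩)
    fun x y => ?_).continuous
  have := hX.dist_le hX hb (ε := 0) (by simp) x y t
  rwa [gronwallBound_ε0, mul_comm] at this

lemma IsFlowOf.unique (hX : IsFlowOf b X) (hb : LipschitzWith K b) {γ : ℝ → (Fin d → ℝ)}
    (hγ : ∀ t, HasDerivAt γ (b (γ t)) t) (t : ℝ) : γ t = X t (γ 0) := by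
  have := ODE_solution_unique_univ (v := fun _ => b) (s := fun _ => Set.univ) (t₀ := 0)
    (f := γ) (g := fun s => X s (γ 0)) (K := K) (fun _ => hb.lipschitzOnWith)
    (fun s => ⟨hγ s, trivial⟩) (fun s => ⟨(hX _).2 s, trivial⟩) (hX _).1.symm
  exact congrFun this t

lemma IsFlowOf.add_time (hX : IsFlowOf b X) (hb : LipschitzWith K b) (t s : ℝ)
    (x : Fin d → ℝ) : X (t + s) x = X t (X s x) := by
  have := hX.unique hb (γ := fun r => X (r + s) x)
    (fun r => ((hX x).2 (r + s)).comp_add_const r s) t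
  simpa using this

lemma IsFlowOf.add_int (hX : IsFlowOf b X) (hb : LipschitzWith K b) (hp : ZdPeriodic b)
    (t : ℝ) (κ : Fin d → ℤ) (x : Fin d → ℝ) :
    X t (x + fun i => (κ i : ℝ)) = X t x + fun i => (κ i : ℝ) := by
  have := hX.unique hb (γ := fun r => X r x + fun i => (κ i : ℝ))
    (fun r => by rw [hp]; exact ((hX x).2 r).add_const _) t
  simpa [(hX x).1] using this.symm

lemma IsFlowOf.periodic_comp (hX : IsFlowOf b X) (hb : LipschitzWith K b) (hp : ZdPeriodic b)
    {F : Type*} {f : (Fin d → ℝ) → F} (hf : ZdPeriodic f) (t : ℝ) :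
    ZdPeriodic fun x => f (X t x) := by
  intro κ x
  simp only [hX.add_int hb hp, hf κ]

lemma IsFlowOf.periodic_sub (hX : IsFlowOf b X) (hb : LipschitzWith K b) (hp : ZdPeriodic b)
    (t : ℝ) : ZdPeriodic fun x => X t x - x := by
  intro κ x
  simp only [hX.add_int hb hp, add_sub_add_right_eq_sub]

end Flow

/-! ### Weak limits of probability measures on the torus -/

lemma exists_ultrafilter_limit_measure {ι : Type*} (U : Ultrafilter ι)
    (μ : ι → Measure (Fin d → ℝ)) [∀ i, IsProbabilityMeasure (μ i)] :
    ∃ ν : Measure (Fin d → ℝ), IsProbabilityMeasure ν ∧ ν (unitCube d)ᶜ = 0 ∧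
      ∀ ψ : (Fin d → ℝ) → ℝ, Continuous ψ → ZdPeriodic ψ →
        Tendsto (fun i => ∫ y, ψ y ∂μ i) U (𝓝 (∫ y, ψ y ∂ν)) := by
  let K : Set (Fin d → ℝ) := Set.Icc 0 1
  have : CompactSpace K := isCompact_iff_compactSpace.1 isCompact_Icc
  let p : (Fin d → ℝ) → K := fun x => ⟨fractPt x, fractPt_mem_Icc x⟩
  have hp : Measurable p := measurable_fractPt.subtype_mk
  have hq : Measurable fun x : K => fractPt (x : Fin d → ℝ) :=
    measurable_fractPt.comp measurable_subtype_coe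
  let P : ι → ProbabilityMeasure K := fun i =>
    ⟨(μ i).map p, Measure.isProbabilityMeasure_map hp.aemeasurable⟩
  obtain ⟨Q, -, hQ⟩ := isCompact_univ.ultrafilter_le_nhds (U.map P) (by simp)
  replace hQ : Tendsto P U (𝓝 Q) := hQ
  refine ⟨(Q : Measure K).map fun x : K => fractPt (x : Fin d → ℝ),
    Measure.isProbabilityMeasure_map hq.aemeasurable, ?_, fun ψ hψ hper => ?_⟩
  · rw [Measure.map_apply hq measurableSet_unitCube.compl]
    convert measure_empty (μ := (Q : Measure K))
    ext x
    simp [fractPt_mem_unitCube]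
  · have h := (ProbabilityMeasure.tendsto_iff_forall_integral_tendsto.1 hQ)
      (BoundedContinuousFunction.mkOfCompact ⟨fun x : K => ψ x, by fun_prop⟩)
    rw [integral_map hq.aemeasurable hψ.measurable.aestronglyMeasurable]
    simp only [periodic_fractPt hper]
    refine h.congr fun i => ?_
    change ∫ x : K, ψ x ∂((μ i).map p) = _
    rw [integral_map hp.aemeasurable (by fun_prop)]
    exact integral_congr_ae (ae_of_all _ fun x => periodic_fractPt hper x)

lemma integral_periodic_apply {f : (Fin d → ℝ) → (Fin d → ℝ)} (hf : Continuous f)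
    (hp : ZdPeriodic f) (μ : Measure (Fin d → ℝ)) [IsFiniteMeasure μ] (i : Fin d) :
    (∫ y, f y ∂μ) i = ∫ y, f y i ∂μ :=
  eval_integral (fun i => (integrable_of_periodic hf hp μ).eval i) i

/-! ### Invariant measures -/

section Invariant

variable {b c : (Fin d → ℝ) → (Fin d → ℝ)} {X Y : ℝ → (Fin d → ℝ) → (Fin d → ℝ)} {K : ℝ≥0}
  {μ : Measure (Fin d → ℝ)}

lemma FlowInvariant.hasDerivAt_integral [IsFiniteMeasure μ] (hμ : FlowInvariant X μ)
    (hX : ∀ t, Continuous (X t))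
    {F : ℝ → (Fin d → ℝ) → ℝ} {g : (Fin d → ℝ) → ℝ}
    (hF : ∀ t, Continuous (F t)) (hFp : ∀ t, ZdPeriodic (F t))
    (hg : Continuous g) (hgp : ZdPeriodic g)
    (hFg : ∀ t x, HasDerivAt (fun s => F s x) (g (X t x)) t) (t : ℝ) :
    HasDerivAt (fun s => ∫ x, F s x ∂μ) (∫ x, g x ∂μ) t := by
  obtain ⟨C, -, hC⟩ := exists_bound_of_periodic hg hgp
  have := (hasDerivAt_integral_of_dominated_loc_of_deriv_le (μ := μ) (F := F)
    (F' := fun s x => g (X s x)) (x₀ := t) (bound := fun _ => C) univ_mem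
    (Eventually.of_forall fun s => (hF s).measurable.aestronglyMeasurable)
    (integrable_of_periodic (hF t) (hFp t) μ)
    (hg.comp (hX t)).measurable.aestronglyMeasurable
    (ae_of_all _ fun x s _ => hC _) (integrable_const _)
    (ae_of_all _ fun x s _ => hFg s x)).2
  rwa [hμ t g hg hgp] at this

/-- A flow whose velocity is `α • c` is a time change of the flow of `c`. -/
lemma IsFlowOf.eq_time_change {α : (Fin d → ℝ) → ℝ} (hX : IsFlowOf (fun y => α y • c y) X)
    (hY : IsFlowOf c Y) (hc : LipschitzWith K c) (hα : Continuous α) (hα0 : ∀ y, 0 ≤ α y)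
    (hα1 : ∀ y, α y ≤ 1) (x : Fin d → ℝ) (t : ℝ) :
    X t x = Y (∫ r in (0 : ℝ)..t, α (X r x)) x := by
  have hτ : ∀ s, HasDerivAt (fun t => ∫ r in (0 : ℝ)..t, α (X r x)) (α (X s x)) s := fun s =>
    ((hα.comp (hX.continuous_time x)).integral_hasStrictDerivAt 0 s).hasDerivAt
  have := ODE_solution_unique_univ (v := fun t u => α (X t x) • c u) (s := fun _ => Set.univ)
    (t₀ := 0) (f := fun s => X s x) (g := fun s => Y (∫ r in (0 : ℝ)..s, α (X r x)) x) (K := K)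
    (fun t => LipschitzWith.lipschitzOnWith <| LipschitzWith.of_dist_le_mul fun u v => by
      rw [dist_smul₀, Real.norm_of_nonneg (hα0 _)]
      exact (mul_le_of_le_one_left dist_nonneg (hα1 _)).trans (hc.dist_le_mul u v))
    (fun s => ⟨(hX x).2 s, trivial⟩)
    (fun s => ⟨((hY x).2 _).scomp s (hτ s), trivial⟩) (by simp [(hX x).1, (hY x).1])
  exact congrFun this t

lemma FlowInvariant.integral_mul_comp_flow [IsFiniteMeasure μ] {α : (Fin d → ℝ) → ℝ}
    {K' : ℝ≥0} (hX : IsFlowOf (fun y => α y • c y) X)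
    (hb : LipschitzWith K' fun y => α y • c y)
    (hμ : FlowInvariant X μ)
    (hY : IsFlowOf c Y) (hc : LipschitzWith K c) (hcp : ZdPeriodic c)
    (hα : Continuous α) (hαp : ZdPeriodic α) (hα0 : ∀ y, 0 ≤ α y) (hα1 : ∀ y, α y ≤ 1)
    {ψ : (Fin d → ℝ) → ℝ} (hψ : Continuous ψ) (hψp : ZdPeriodic ψ) (t : ℝ) :
    ∫ y, α y * ψ (Y t y) ∂μ = ∫ y, α y * ψ y ∂μ := by
  obtain ⟨C, -, hC⟩ := exists_bound_of_periodic hψ hψp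
  have hYc := hY.continuous hc
  have hψY : ∀ y, Continuous fun r => ψ (Y r y) := fun y => hψ.comp (hY.continuous_time y)
  have hψYp : ∀ r, ZdPeriodic fun y => ψ (Y r y) := hY.periodic_comp hc hcp hψp
  set F : (Fin d → ℝ) → ℝ := fun y => ∫ r in (0 : ℝ)..t, ψ (Y r y) with hF
  have hFc : Continuous F := by
    refine intervalIntegral.continuous_of_dominated_interval (bound := fun _ => C)
      (fun y => (hψY y).aestronglyMeasurable) (fun y => ae_of_all _ fun r _ => hC _)
      intervalIntegrable_const (ae_of_all _ fun r _ => hψ.comp (hYc r))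
  have hFp : ZdPeriodic F := by
    intro κ y
    exact intervalIntegral.integral_congr fun r _ => hψYp r κ y
  have hderiv : ∀ s y, HasDerivAt (fun s => F (X s y))
      ((fun y => α y * (ψ (Y t y) - ψ y)) (X s y)) s := by
    intro s y
    set τ : ℝ → ℝ := fun s => ∫ r in (0 : ℝ)..s, α (X r y)
    have hτ : HasDerivAt τ (α (X s y)) s :=
      ((hα.comp (hX.continuous_time y)).integral_hasStrictDerivAt 0 s).hasDerivAt
    have hXY : ∀ s, X s y = Y (τ s) y := hX.eq_time_change hY hc hα hα0 hα1 y
    have hG : ∀ u, HasDerivAt (fun u => ∫ r in (0 : ℝ)..u, ψ (Y r y)) (ψ (Y u y)) u := fun u =>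
      ((hψY y).integral_hasStrictDerivAt 0 u).hasDerivAt
    have hFG : (fun s => F (X s y)) = fun s =>
        (∫ r in (0 : ℝ)..(t + τ s), ψ (Y r y)) - ∫ r in (0 : ℝ)..(τ s), ψ (Y r y) := by
      funext s
      rw [intervalIntegral.integral_interval_sub_left ((hψY y).intervalIntegrable _ _)
        ((hψY y).intervalIntegrable _ _)]
      simp only [hF, hXY, ← hY.add_time hc]
      rw [intervalIntegral.integral_comp_add_right (fun r => ψ (Y r y)), zero_add]
    rw [hFG]
    have h1 := (hG (t + τ s)).comp s (hτ.const_add t)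
    have h2 := (hG (τ s)).comp s hτ
    refine (h1.sub h2).congr_deriv ?_
    simp only
    rw [hXY s, ← hY.add_time hc]
    ring
  have hYt : Integrable (fun y => α y * ψ (Y t y)) μ :=
    integrable_of_periodic (hα.mul (hψ.comp (hYc t)))
      (fun κ y => congrArg₂ (· * ·) (hαp κ y) (hψYp t κ y)) μ
  have hY0 : Integrable (fun y => α y * ψ y) μ :=
    integrable_of_periodic (hα.mul hψ) (fun κ y => congrArg₂ (· * ·) (hαp κ y) (hψp κ y)) μ
  have hXc := hX.continuous hb
  have h := hμ.hasDerivAt_integral hXc (fun s => hFc.comp (hXc s))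
    (hX.periodic_comp hb (hαp.smul hcp) hFp)
    (hα.mul ((hψ.comp (hYc t)).sub hψ))
    (fun κ y => congrArg₂ (· * ·) (hαp κ y) (congrArg₂ (· - ·) (hψYp t κ y) (hψp κ y)))
    hderiv 0
  have h' : (fun s => ∫ y, (F ∘ X s) y ∂μ) = fun _ => ∫ y, F y ∂μ :=
    funext fun s => hμ s F hFc hFp
  rw [h'] at h
  have h0 := h.unique (hasDerivAt_const _ _)
  simp only [Pi.mul_apply, Pi.sub_apply, mul_sub, Function.comp_apply] at h0
  rwa [integral_sub hYt hY0, sub_eq_zero] at h0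

lemma integral_smul_eq_of_rotationSet_eq_singleton [IsProbabilityMeasure μ]
    {α : (Fin d → ℝ) → ℝ} {K' : ℝ≥0} (hX : IsFlowOf (fun y => α y • c y) X)
    (hb : LipschitzWith K' fun y => α y • c y)
    (hμ : FlowInvariant X μ) (hμ1 : μ (unitCube d)ᶜ = 0)
    (hY : IsFlowOf c Y) (hc : LipschitzWith K c) (hcp : ZdPeriodic c)
    (hα : Continuous α) (hαp : ZdPeriodic α) (hα0 : ∀ y, 0 ≤ α y) (hα1 : ∀ y, α y ≤ 1)
    {ζ : Fin d → ℝ} (hζ : rotationSet c Y = {ζ}) :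
    ∫ y, α y • c y ∂μ = (∫ y, α y ∂μ) • ζ := by
  have hαi : Integrable α μ := integrable_of_periodic hα hαp μ
  set m := ∫ y, α y ∂μ with hm
  have hm0 : 0 ≤ m := integral_nonneg hα0
  rcases hm0.eq_or_lt with h0 | h0
  · have : α =ᵐ[μ] 0 := (integral_eq_zero_iff_of_nonneg hα0 hαi).1 h0.symm
    rw [← h0, zero_smul]
    refine integral_eq_zero_of_ae (this.mono fun y hy => ?_)
    simp [hy]
  set ν : Measure (Fin d → ℝ) := μ.withDensity fun y => ENNReal.ofReal (m⁻¹ * α y) with hν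
  have hint : ∀ {G : Type} [NormedAddCommGroup G] [NormedSpace ℝ G] (f : (Fin d → ℝ) → G),
      ∫ y, f y ∂ν = m⁻¹ • ∫ y, α y • f y ∂μ := by
    intro G _ _ f
    rw [hν, integral_withDensity_eq_integral_toReal_smul (by fun_prop)
      (ae_of_all _ fun _ => ENNReal.ofReal_lt_top), ← integral_smul]
    refine integral_congr_ae (ae_of_all _ fun y => ?_)
    simp only [ENNReal.toReal_ofReal (mul_nonneg (inv_nonneg.2 hm0) (hα0 y)), mul_smul]
  have hνp : IsProbabilityMeasure ν := by
    refine ⟨?_⟩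
    rw [hν, withDensity_apply _ MeasurableSet.univ, Measure.restrict_univ,
      ← ofReal_integral_eq_lintegral_ofReal (hαi.const_mul _)
        (ae_of_all _ fun y => mul_nonneg (inv_nonneg.2 hm0) (hα0 y)),
      integral_const_mul, ← hm, inv_mul_cancel₀ h0.ne', ENNReal.ofReal_one]
  have hmem : ∫ y, c y ∂ν ∈ rotationSet c Y := by
    refine ⟨ν, hνp, withDensity_absolutelyContinuous _ _ hμ1, fun t ψ hψ hψp => ?_, rfl⟩
    rw [hint, hint]
    congr 1
    exact hμ.integral_mul_comp_flow hX hb hY hc hcp hα hαp hα0 hα1 hψ hψp t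
  rw [hζ, Set.mem_singleton_iff, hint] at hmem
  rw [← hmem, smul_inv_smul₀ h0.ne']

lemma convex_rotationSet (hX : IsFlowOf b X) (hb : LipschitzWith K b) (hbp : ZdPeriodic b) :
    Convex ℝ (rotationSet b X) := by
  rintro _ ⟨μ, hμ, hμ1, hμX, rfl⟩ _ ⟨ν, hν, hν1, hνX, rfl⟩ s t hs ht hst
  have hint : ∀ {G : Type} [NormedAddCommGroup G] [NormedSpace ℝ G] [MeasurableSpace G]
      [BorelSpace G] [SecondCountableTopology G] (f : (Fin d → ℝ) → G),
      Continuous f → ZdPeriodic f →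
      ∫ y, f y ∂(ENNReal.ofReal s • μ + ENNReal.ofReal t • ν)
        = s • ∫ y, f y ∂μ + t • ∫ y, f y ∂ν := by
    intro G _ _ _ _ _ f hf hfp
    rw [integral_add_measure
      ((integrable_of_periodic hf hfp μ).smul_measure ENNReal.ofReal_ne_top)
      ((integrable_of_periodic hf hfp ν).smul_measure ENNReal.ofReal_ne_top),
      integral_smul_measure, integral_smul_measure, ENNReal.toReal_ofReal hs,
      ENNReal.toReal_ofReal ht]
  refine ⟨ENNReal.ofReal s • μ + ENNReal.ofReal t • ν, ⟨?_⟩, by simp [hμ1, hν1],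
    fun r ψ hψ hψp => ?_, (hint b hb.continuous hbp).symm⟩
  · simp [← ENNReal.ofReal_add hs ht, hst]
  · rw [hint _ hψ hψp, hint (fun y => ψ (X r y)) (hψ.comp (hX.continuous hb r))
      (hX.periodic_comp hb hbp hψp r), hμX r ψ hψ hψp,
      hνX r ψ hψ hψp]

lemma zero_mem_rotationSet (hX : IsFlowOf b X) (hb : LipschitzWith K b) (hbp : ZdPeriodic b)
    {x₀ : Fin d → ℝ} (hx₀ : b x₀ = 0) : 0 ∈ rotationSet b X := by
  have h0 : b (fractPt x₀) = 0 := (periodic_fractPt hbp x₀).trans hx₀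
  have hfix : ∀ t, X t (fractPt x₀) = fractPt x₀ := fun t =>
    (hX.unique hb (γ := fun _ => fractPt x₀)
      (fun t => by simpa [h0] using hasDerivAt_const t (fractPt x₀)) t).symm
  refine ⟨Measure.dirac (fractPt x₀), inferInstance, ?_, fun t ψ _ _ => ?_, ?_⟩
  · rw [Measure.dirac_apply' _ measurableSet_unitCube.compl]
    simp [fractPt_mem_unitCube]
  · rw [integral_dirac, integral_dirac, hfix]
  · rw [integral_dirac, h0]

/-- Any weak limit of asymptotically invariant probability measures is invariant. -/
lemma exists_mem_rotationSet_tendsto {ι : Type*} (U : Ultrafilter ι)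
    (hX : IsFlowOf b X) (hb : LipschitzWith K b) (hbp : ZdPeriodic b)
    (μ : ι → Measure (Fin d → ℝ)) [∀ i, IsProbabilityMeasure (μ i)]
    (h : ∀ (t : ℝ) (ψ : (Fin d → ℝ) → ℝ), Continuous ψ → ZdPeriodic ψ →
      Tendsto (fun i => ∫ y, ψ (X t y) ∂μ i - ∫ y, ψ y ∂μ i) U (𝓝 0)) :
    ∃ v ∈ rotationSet b X, Tendsto (fun i => ∫ y, b y ∂μ i) U (𝓝 v) := by
  obtain ⟨ν, hν, hν1, hlim⟩ := exists_ultrafilter_limit_measure U μ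
  refine ⟨∫ y, b y ∂ν, ⟨ν, hν, hν1, fun t ψ hψ hψp => ?_, rfl⟩, ?_⟩
  · have := (hlim _ (hψ.comp (hX.continuous hb t)) (hX.periodic_comp hb hbp hψp t)).sub
      (hlim ψ hψ hψp)
    exact sub_eq_zero.1 (tendsto_nhds_unique this (h t ψ hψ hψp))
  · refine tendsto_pi_nhds.2 fun i => ?_
    simp only [integral_periodic_apply hb.continuous hbp]
    exact hlim (fun y => b y i) ((continuous_apply i).comp hb.continuous)
      fun κ y => congrFun (hbp κ y) i

lemma exists_mem_rotationSet_tendsto_of_perturbation {ι : Type*} (U : Ultrafilter ι)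
    (hX : IsFlowOf b X) (hb : LipschitzWith K b) (hbp : ZdPeriodic b)
    {bn : ι → (Fin d → ℝ) → (Fin d → ℝ)} {Xn : ι → ℝ → (Fin d → ℝ) → (Fin d → ℝ)}
    (hXn : ∀ i, IsFlowOf (bn i) (Xn i)) (hbn : ∀ i, Continuous (bn i))
    (hbnp : ∀ i, ZdPeriodic (bn i)) (hXnc : ∀ i t, Continuous (Xn i t))
    (hunif : ∀ ε > 0, ∀ᶠ i in (U : Filter ι), ∀ y, dist (bn i y) (b y) ≤ ε)
    {v : ι → Fin d → ℝ} (hv : ∀ i, v i ∈ rotationSet (bn i) (Xn i)) :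
    ∃ w ∈ rotationSet b X, Tendsto v U (𝓝 w) := by
  choose μ hμ _ hμX hμv using hv
  have hdist : ∀ (i : ι) {f g : (Fin d → ℝ) → (Fin d → ℝ)} {ε : ℝ},
      (∀ y, dist (f y) (g y) ≤ ε) → Continuous f → Continuous g → ZdPeriodic f →
      ZdPeriodic g → dist (∫ y, f y ∂μ i) (∫ y, g y ∂μ i) ≤ ε := by
    intro i f g ε hfg hf hg hfp hgp
    rw [dist_eq_norm, ← integral_sub (integrable_of_periodic hf hfp _)
      (integrable_of_periodic hg hgp _)]
    simpa using norm_integral_le_of_norm_le_const (μ := μ i)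
      (ae_of_all _ fun y => (dist_eq_norm (f y) (g y)) ▸ hfg y)
  obtain ⟨w, hw, hlim⟩ := exists_mem_rotationSet_tendsto U hX hb hbp μ fun t ψ hψ hψp => by
    have hψu := Metric.uniformContinuous_iff.1 (uniformContinuous_of_periodic hψ hψp)
    rw [Metric.tendsto_nhds]
    intro ε hε
    obtain ⟨δ, hδ, hψδ⟩ := hψu (ε / 2) (half_pos hε)
    have hg : Tendsto (fun η => gronwallBound 0 K η |t|) (𝓝[>] 0) (𝓝 0) := by
      have := (gronwallBound_continuous_ε 0 K |t|).tendsto 0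
      rw [gronwallBound_ε0_δ0] at this
      exact this.mono_left nhdsWithin_le_nhds
    obtain ⟨η, hη, hη0⟩ := ((hg.eventually_lt_const hδ).and self_mem_nhdsWithin).exists
    filter_upwards [hunif η hη0] with i hi
    have hclose : ∀ y, ‖ψ (X t y) - ψ (Xn i t y)‖ ≤ ε / 2 := fun y => by
      have := hX.dist_le (hXn i) hb hi y y t
      rw [dist_self] at this
      rw [← dist_eq_norm]
      exact (hψδ (this.trans_lt hη)).le
    have hi1 : Integrable (fun y => ψ (X t y)) (μ i) :=
      integrable_of_periodic (hψ.comp (hX.continuous hb t))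
        (hX.periodic_comp hb hbp hψp t) (μ i)
    obtain ⟨C, -, hC⟩ := exists_bound_of_periodic hψ hψp
    have hi2 : Integrable (fun y => ψ (Xn i t y)) (μ i) :=
      Integrable.of_bound (hψ.comp (hXnc i t)).measurable.aestronglyMeasurable C
        (ae_of_all _ fun y => hC _)
    rw [dist_zero_right, ← hμX i t ψ hψ hψp]
    refine lt_of_le_of_lt ?_ (half_lt_self hε)
    rw [← integral_sub hi1 hi2]
    simpa using norm_integral_le_of_norm_le_const (μ := μ i) (ae_of_all _ hclose)
  refine ⟨w, hw, ?_⟩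
  rw [Metric.tendsto_nhds] at hlim ⊢
  intro ε hε
  filter_upwards [hlim (ε / 2) (half_pos hε), hunif (ε / 2) (half_pos hε)] with i h1 h2
  have h3 := hdist i h2 (hbn i) hb.continuous (hbnp i) hbp
  rw [← hμv i] at h3
  have := dist_triangle (v i) (∫ y, b y ∂μ i) w
  linarith

lemma IsFlowOf.sub_eq_integral (hX : IsFlowOf b X) (hb : Continuous b) (x : Fin d → ℝ) (t : ℝ) :
    X t x - x = ∫ s in (0 : ℝ)..t, b (X s x) := by
  rw [intervalIntegral.integral_eq_sub_of_hasDerivAt (fun s _ => (hX x).2 s)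
    ((hb.comp (hX.continuous_time x)).intervalIntegrable _ _), (hX x).1]

/-- Krylov–Bogoliubov: the limit points of `X(n,x)/n` belong to the rotation set. -/
lemma exists_mem_rotationSet_tendsto_orbit (U : Ultrafilter ℕ) (hU : (U : Filter ℕ) ≤ atTop)
    (hX : IsFlowOf b X) (hb : LipschitzWith K b) (hbp : ZdPeriodic b) (x : Fin d → ℝ) :
    ∃ v ∈ rotationSet b X, Tendsto (fun n : ℕ => (n : ℝ)⁻¹ • X n x) U (𝓝 v) := by
  have hinv : Tendsto (fun n : ℕ => (n : ℝ)⁻¹) U (𝓝 0) :=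
    tendsto_inv_atTop_nhds_zero_nat.mono_left hU
  have hpos : ∀ᶠ n : ℕ in U, (n : ℝ) ≠ 0 :=
    hU ((eventually_ne_atTop 0).mono fun n hn => Nat.cast_ne_zero.2 hn)
  have horb : ∀ n : ℕ, Continuous fun s : ℝ => X (n * s) x := fun n =>
    (hX.continuous_time x).comp (continuous_const.mul continuous_id)
  let μ : ℕ → Measure (Fin d → ℝ) := fun n =>
    (volume.restrict (Set.Ioc (0 : ℝ) 1)).map fun s => X (n * s) x
  have : ∀ n, IsProbabilityMeasure (μ n) := fun n => by
    have : IsProbabilityMeasure (volume.restrict (Set.Ioc (0 : ℝ) 1)) := ⟨by simp⟩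
    exact Measure.isProbabilityMeasure_map (horb n).measurable.aemeasurable
  have hint : ∀ {G : Type} [NormedAddCommGroup G] [NormedSpace ℝ G] [MeasurableSpace G]
      [BorelSpace G] [SecondCountableTopology G] (f : (Fin d → ℝ) → G) (n : ℕ),
      Continuous f → ∫ y, f y ∂μ n = ∫ s in (0 : ℝ)..1, f (X (n * s) x) := by
    intro G _ _ _ _ _ f n hf
    rw [integral_map (horb n).measurable.aemeasurable hf.measurable.aestronglyMeasurable,
      intervalIntegral.integral_of_le zero_le_one]
  obtain ⟨v, hv, hlim⟩ := exists_mem_rotationSet_tendsto U hX hb hbp μ fun t ψ hψ hψp => by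
    obtain ⟨C, -, hC⟩ := exists_bound_of_periodic hψ hψp
    have hg : Continuous fun u => ψ (X u x) := hψ.comp (hX.continuous_time x)
    have hgi : ∀ p q : ℝ, IntervalIntegrable (fun u => ψ (X u x)) volume p q := fun p q =>
      hg.intervalIntegrable _ _
    have hlim0 : Tendsto (fun n : ℕ => (n : ℝ)⁻¹ * (C * |t| + C * |t|)) U (𝓝 0) := by
      simpa using hinv.mul_const (C * |t| + C * |t|)
    refine squeeze_zero_norm' ?_ hlim0
    filter_upwards [hpos] with n hn
    rw [hint (fun y => ψ (X t y)) n (hψ.comp (hX.continuous hb t)), hint ψ n hψ]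
    simp only [← hX.add_time hb]
    rw [intervalIntegral.integral_comp_add_mul (fun u => ψ (X u x)) hn,
      intervalIntegral.integral_comp_mul_left (fun u => ψ (X u x)) hn, ← smul_sub, norm_smul,
      mul_zero, mul_one, add_zero,
      intervalIntegral.integral_interval_sub_interval_comm (hgi _ _) (hgi _ _) (hgi _ _),
      norm_inv, Real.norm_natCast]
    refine mul_le_mul_of_nonneg_left ((norm_sub_le _ _).trans (add_le_add ?_ ?_)) (by positivity)
    · simpa using intervalIntegral.norm_integral_le_of_norm_le_const
        (a := t) (b := 0) fun u _ => hC (X u x)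
    · simpa using intervalIntegral.norm_integral_le_of_norm_le_const
        (a := t + n) (b := n) fun u _ => hC (X u x)
  refine ⟨v, hv, ?_⟩
  have hsum := hlim.add (hinv.smul_const x)
  rw [zero_smul, add_zero] at hsum
  refine hsum.congr' ?_
  filter_upwards [hpos] with n hn
  rw [hint b n hb.continuous, intervalIntegral.integral_comp_mul_left (fun u => b (X u x)) hn,
    mul_zero, mul_one, ← hX.sub_eq_integral hb.continuous, ← smul_add, sub_add_cancel]

/-- The mean displacement with respect to an invariant measure grows linearly. -/
lemma FlowInvariant.integral_displacement [IsFiniteMeasure μ] (hμ : FlowInvariant X μ)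
    (hX : IsFlowOf b X) (hb : LipschitzWith K b) (hbp : ZdPeriodic b) (i : Fin d) (t : ℝ) :
    ∫ x, (X t x i - x i) ∂μ = t * (∫ x, b x ∂μ) i := by
  have h := hμ.hasDerivAt_integral (hX.continuous hb)
    (F := fun s x => X s x i - x i) (g := fun y => b y i)
    (fun s => ((continuous_apply i).comp (hX.continuous hb s)).sub (continuous_apply i))
    (fun s κ x => congrFun (hX.periodic_sub hb hbp s κ x) i)
    ((continuous_apply i).comp hb.continuous) (fun κ x => congrFun (hbp κ x) i)
    (fun s x => (hasDerivAt_pi.1 ((hX x).2 s) i).sub_const _)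
  rw [integral_periodic_apply hb.continuous hbp]
  set m := ∫ x, b x i ∂μ
  have h' : ∀ s, HasDerivAt (fun s => ∫ x, (X s x i - x i) ∂μ - s * m) 0 s := fun s => by
    have h2 := (h s).sub ((hasDerivAt_id s).mul_const m)
    rw [one_mul, sub_self] at h2
    exact h2
  have := is_const_of_deriv_eq_zero (fun s => (h' s).differentiableAt) (fun s => (h' s).deriv) t 0
  simp only [(hX _).1, sub_self, integral_zero, zero_mul] at this
  exact sub_eq_zero.1 this

/-- If the rotation set is a segment `[0,ζ]`, its extremity `ζ` is a limit point of
`X(n,x)/n` for some `x`. -/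
lemma mem_limitPointsSet_of_rotationSet_eq_segment (hX : IsFlowOf b X) (hb : LipschitzWith K b)
    (hbp : ZdPeriodic b) {ζ : Fin d → ℝ} (hrot : rotationSet b X = segment ℝ 0 ζ) :
    ζ ∈ limitPointsSet X := by
  have horb : ∀ (x : Fin d → ℝ) (U : Ultrafilter ℕ), (U : Filter ℕ) ≤ atTop →
      ∃ θ ≤ (1 : ℝ), Tendsto (fun n : ℕ => (n : ℝ)⁻¹ • X n x) U (𝓝 (θ • ζ)) := by
    intro x U hU
    obtain ⟨v, hv, hlim⟩ := exists_mem_rotationSet_tendsto_orbit U hU hX hb hbp x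
    rw [hrot] at hv
    obtain ⟨p, θ, hp, hθ, hpθ, rfl⟩ := hv
    exact ⟨θ, by linarith, by simpa using hlim⟩
  have hmem : ∀ (x : Fin d → ℝ) (U : Ultrafilter ℕ), (U : Filter ℕ) ≤ atTop →
      Tendsto (fun n : ℕ => (n : ℝ)⁻¹ • X n x) U (𝓝 ζ) → ζ ∈ limitPointsSet X :=
    fun x U hU h => Set.mem_iUnion.2 ⟨x, mapClusterPt_iff_ultrafilter.2 ⟨U, hU, h⟩⟩
  by_cases hζ : ζ = 0
  · obtain ⟨θ, -, h⟩ := horb 0 (Ultrafilter.of atTop) (Ultrafilter.of_le _)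
    exact hmem 0 _ (Ultrafilter.of_le _) (by simpa [hζ] using h)
  obtain ⟨i, hi⟩ := Function.ne_iff.1 hζ
  rw [Pi.zero_apply] at hi
  obtain ⟨μ, hμ, -, hμX, hμζ⟩ : ζ ∈ rotationSet b X := hrot ▸ right_mem_segment ℝ 0 ζ
  obtain ⟨C, hC0, hC⟩ := exists_bound_of_periodic hb.continuous hbp
  set g : ℕ → (Fin d → ℝ) → ℝ := fun n x => ((n : ℝ)⁻¹ * (X n x i - x i)) * (ζ i)⁻¹ with hg
  have hgc : ∀ n, Continuous (g n) := fun n =>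
    (continuous_const.mul (((continuous_apply i).comp (hX.continuous hb n)).sub
      (continuous_apply i))).mul continuous_const
  have hg_bound : ∀ n x, ‖g n x‖ ≤ C * |(ζ i)⁻¹| := by
    intro n x
    rw [hg]
    simp only [norm_mul, norm_inv, Real.norm_eq_abs, Nat.abs_cast, abs_inv]
    refine mul_le_mul_of_nonneg_right ?_ (by positivity)
    have h1 : |X n x i - x i| ≤ C * n := by
      refine (norm_le_pi_norm (X n x - x) i).trans ?_
      rw [hX.sub_eq_integral hb.continuous]
      simpa using intervalIntegral.norm_integral_le_of_norm_le_const
        (a := 0) (b := (n : ℝ)) fun u _ => hC (X u x)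
    rcases eq_or_ne n 0 with rfl | hn
    · simpa using hC0
    · rw [inv_mul_le_iff₀ (by positivity), mul_comm]
      exact h1
  have hgi : ∀ n, Integrable (g n) μ := fun n =>
    Integrable.of_bound (hgc n).measurable.aestronglyMeasurable _ (ae_of_all _ (hg_bound n))
  have hg_int : ∀ n : ℕ, n ≠ 0 → ∫ x, g n x ∂μ = 1 := by
    intro n hn
    have : (n : ℝ) ≠ 0 := Nat.cast_ne_zero.2 hn
    simp only [hg]
    rw [integral_mul_const, integral_const_mul, hμX.integral_displacement hX hb hbp, ← hμζ]
    field_simp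
  have hg_lim : ∀ (x : Fin d → ℝ) (U : Ultrafilter ℕ) (θ : ℝ), (U : Filter ℕ) ≤ atTop →
      Tendsto (fun n : ℕ => (n : ℝ)⁻¹ • X n x) U (𝓝 (θ • ζ)) →
      Tendsto (fun n => g n x) U (𝓝 θ) := by
    intro x U θ hU h
    have h1 := (tendsto_inv_atTop_nhds_zero_nat (𝕜 := ℝ)).mono_left hU
    have h2 := ((tendsto_pi_nhds.1 h i).sub (h1.mul_const (x i))).mul_const (ζ i)⁻¹
    simp only [Pi.smul_apply, smul_eq_mul, zero_mul, sub_zero, mul_inv_cancel_right₀ hi,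
      ← mul_sub] at h2
    exact h2
  have hmax : ∀ x, Tendsto (fun n => max (g n x) 1) atTop (𝓝 1) := by
    intro x
    refine (tendsto_iff_ultrafilter _ _ _).2 fun U hU => ?_
    obtain ⟨θ, hθ, h⟩ := horb x U hU
    simpa [max_eq_right hθ] using (hg_lim x U θ hU h).max (tendsto_const_nhds (x := (1 : ℝ)))
  have hmax_int : ∀ n, Integrable (fun x => max (g n x) 1) μ := fun n =>
    (hgi n).sup (integrable_const 1)
  have hL1 : Tendsto (fun n => ∫ x, (max (g n x) 1 - g n x) ∂μ) atTop (𝓝 0) := by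
    have h1 : Tendsto (fun n => ∫ x, max (g n x) 1 ∂μ) atTop (𝓝 (∫ _, (1 : ℝ) ∂μ)) := by
      refine tendsto_integral_of_dominated_convergence (fun _ => max (C * |(ζ i)⁻¹|) 1)
        (fun n => (hmax_int n).aestronglyMeasurable) (integrable_const _)
        (fun n => ae_of_all _ fun x => ?_) (ae_of_all _ hmax)
      rw [Real.norm_of_nonneg (zero_le_one.trans (le_max_right _ _))]
      exact max_le_max ((le_abs_self _).trans (hg_bound n x)) le_rfl
    have h2 := h1.sub (tendsto_const_nhds (x := (1 : ℝ)))
    simp only [integral_const, probReal_univ, smul_eq_mul, mul_one, sub_self] at h2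
    refine h2.congr' ?_
    filter_upwards [eventually_ne_atTop 0] with n hn
    rw [integral_sub (hmax_int n) (hgi n), hg_int n hn]
  have hmeas : TendstoInMeasure μ (fun n x => max (g n x) 1 - g n x) atTop 0 := by
    refine tendstoInMeasure_of_tendsto_eLpNorm one_ne_zero
      (fun n => ((hmax_int n).sub (hgi n)).aestronglyMeasurable)
      aestronglyMeasurable_zero ?_
    have := ENNReal.tendsto_ofReal hL1
    rw [ENNReal.ofReal_zero] at this
    refine this.congr fun n => ?_
    have hi : Integrable (fun x => max (g n x) 1 - g n x) μ := (hmax_int n).sub (hgi n)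
    rw [sub_zero, eLpNorm_one_eq_lintegral_enorm,
      ← ofReal_integral_norm_eq_lintegral_enorm hi]
    congr 1
    refine integral_congr_ae (ae_of_all _ fun x => ?_)
    exact (Real.norm_of_nonneg (sub_nonneg.2 (le_max_left _ _))).symm
  obtain ⟨ns, hns, hae⟩ := hmeas.exists_seq_tendsto_ae
  obtain ⟨x, hx⟩ := hae.exists
  let U : Ultrafilter ℕ := (Ultrafilter.of atTop).map ns
  have hU : (U : Filter ℕ) ≤ atTop := hns.tendsto_atTop.mono_left (Ultrafilter.of_le _)
  obtain ⟨θ, -, h⟩ := horb x U hU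
  have h1 : Tendsto (fun n => g n x) U (𝓝 1) := by
    have h2 := ((hmax x).comp hns.tendsto_atTop).sub hx
    simp only [Function.comp_apply, sub_sub_cancel, Pi.zero_apply, sub_zero] at h2
    exact tendsto_map'_iff.2 (h2.mono_left (Ultrafilter.of_le _))
  have hθ1 : θ = 1 := tendsto_nhds_unique (hg_lim x U θ hU h) h1
  exact hmem x U hU (by simpa [hθ1] using h)

end Invariant

end TorusFlow

/-- (Perturbation theorem, vanishing case.) Let `b = ρΦ` as in the
perturbation theorem, with the rotation set of `b_n = ρ_n Φ` a singleton `{ζ_n}` for each `n`.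
If `ρ` vanishes at some point, then `(ζ_n)` converges to some `ζ`, the rotation set `C_b`
equals the closed segment `[0,ζ]`, and both `0` and `ζ` belong to `A_b`. -/
theorem perturbation_singleton_vanishing_case {d : ℕ} (hd : 1 ≤ d)
    (ρ : (Fin d → ℝ) → ℝ) (hρ : ContDiff ℝ 1 ρ) (hρper : ZdPeriodic ρ)
    (hρ0 : ∀ y, 0 ≤ ρ y) (hρne : ∃ y, ρ y ≠ 0)
    (Φ : (Fin d → ℝ) → (Fin d → ℝ)) (hΦ : ContDiff ℝ 1 Φ) (hΦper : ZdPeriodic Φ)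
    (hΦne : ∀ y, Φ y ≠ 0)
    (X : ℝ → (Fin d → ℝ) → (Fin d → ℝ)) (hX : IsFlowOf (fun y => ρ y • Φ y) X)
    (ρn : ℕ → (Fin d → ℝ) → ℝ)
    (hρn : ∀ n, ContDiff ℝ 1 (ρn n)) (hρnper : ∀ n, ZdPeriodic (ρn n))
    (hρnpos : ∀ n y, 0 < ρn n y) (hle : ∀ n y, ρ y ≤ ρn n y)
    (hunif : TendstoUniformly ρn ρ atTop)
    (Xn : ℕ → ℝ → (Fin d → ℝ) → (Fin d → ℝ))
    (hXn : ∀ n, IsFlowOf (fun y => ρn n y • Φ y) (Xn n))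
    (ζn : ℕ → Fin d → ℝ)
    (hsin : ∀ n, rotationSet (fun y => ρn n y • Φ y) (Xn n) = {ζn n})
    (hvan : ∃ x₀, ρ x₀ = 0) :
    ∃ ζ : Fin d → ℝ, Tendsto ζn atTop (nhds ζ) ∧
      rotationSet (fun y => ρ y • Φ y) X = segment ℝ 0 ζ ∧
      0 ∈ limitPointsSet X ∧ ζ ∈ limitPointsSet X := by
  set b : (Fin d → ℝ) → (Fin d → ℝ) := fun y => ρ y • Φ y with hb
  obtain ⟨K, hK⟩ : ∃ K, LipschitzWith K b :=
    exists_lipschitzWith_of_periodic (hρ.smul hΦ) (hρper.smul hΦper)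
  have hbp : ZdPeriodic b := hρper.smul hΦper
  have hbnp : ∀ n, ZdPeriodic fun y => ρn n y • Φ y := fun n => (hρnper n).smul hΦper
  choose Kn hKn using fun n => exists_lipschitzWith_of_periodic ((hρn n).smul hΦ) (hbnp n)
  obtain ⟨C, hC0, hC⟩ := exists_bound_of_periodic hΦ.continuous hΦper
  obtain ⟨x₀, hx₀⟩ := hvan
  have hbx₀ : b x₀ = 0 := by simp [hb, hx₀]
  have hclose : ∀ ε > 0, ∀ᶠ n in atTop, ∀ y, dist (ρn n y • Φ y) (b y) ≤ ε := by
    intro ε hε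
    filter_upwards [Metric.tendstoUniformly_iff.1 hunif (ε / (C + 1)) (by positivity)] with n hn y
    rw [dist_eq_norm, hb, ← sub_smul, norm_smul, ← dist_eq_norm, dist_comm]
    calc dist (ρ y) (ρn n y) * ‖Φ y‖ ≤ ε / (C + 1) * (C + 1) :=
          mul_le_mul (hn y).le ((hC y).trans (by linarith)) (norm_nonneg _) (by positivity)
      _ = ε := div_mul_cancel₀ _ (by positivity)
  have hlim : ∀ U : Ultrafilter ℕ, (U : Filter ℕ) ≤ atTop →
      ∃ w ∈ rotationSet b X, Tendsto ζn U (nhds w) := fun U hU =>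
    exists_mem_rotationSet_tendsto_of_perturbation U hX hK hbp hXn (fun n => (hKn n).continuous)
      hbnp (fun n => (hXn n).continuous (hKn n)) (fun ε hε => hU (hclose ε hε))
      fun n => by rw [hsin n]; rfl
  have hscale : ∀ v ∈ rotationSet b X, ∃ (m : ℝ) (mn : ℕ → ℝ), 0 ≤ m ∧ m ≤ 1 ∧
      Tendsto mn atTop (nhds m) ∧ ∀ n, v = mn n • ζn n := by
    rintro _ ⟨μ, hμ, hμ1, hμX, rfl⟩
    have h0 : ∀ n y, 0 ≤ ρ y / ρn n y := fun n y => div_nonneg (hρ0 y) (hρnpos n y).le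
    have h1 : ∀ n y, ρ y / ρn n y ≤ 1 := fun n y => div_le_one_of_le₀ (hle n y) (hρnpos n y).le
    have hc : ∀ n, Continuous fun y => ρ y / ρn n y := fun n =>
      hρ.continuous.div (hρn n).continuous fun y => (hρnpos n y).ne'
    have hα : ∀ n, b = fun y => (ρ y / ρn n y) • ρn n y • Φ y := fun n => by
      funext y
      rw [smul_smul, div_mul_cancel₀ _ (hρnpos n y).ne']
    have hm : Tendsto (fun n => ∫ y, ρ y / ρn n y ∂μ) atTop
        (nhds (∫ y, ρ y / ρ y ∂μ)) := by
      refine tendsto_integral_of_dominated_convergence (fun _ => 1)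
        (fun n => (hc n).measurable.aestronglyMeasurable) (integrable_const _)
        (fun n => ae_of_all _ fun y => ?_) (ae_of_all _ fun y => ?_)
      · rw [Real.norm_of_nonneg (h0 n y)]
        exact h1 n y
      · by_cases hy : ρ y = 0
        · simp [hy]
        · exact tendsto_const_nhds.div (hunif.tendsto_at y) hy
    refine ⟨_, _, ge_of_tendsto' hm fun n => integral_nonneg (h0 n),
      le_of_tendsto' hm fun n => ?_, hm, fun n => ?_⟩
    · simpa using integral_mono_of_nonneg (μ := μ) (ae_of_all _ (h0 n)) (integrable_const (1 : ℝ))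
        (ae_of_all _ (h1 n))
    · have := integral_smul_eq_of_rotationSet_eq_singleton (μ := μ)
        (by rw [← hα n]; exact hX) (by rw [← hα n]; exact hK) hμX hμ1 (hXn n) (hKn n) (hbnp n) (hc n)
        (fun κ y => by simp only [hρper κ y, hρnper n κ y]) (h0 n) (h1 n) (hsin n)
      rw [← this]
      exact congrArg (fun f => ∫ y, f y ∂μ) (hα n)
  obtain ⟨ζ, hζ⟩ : ∃ ζ, Tendsto ζn atTop (nhds ζ) := by
    by_cases hne : ∃ v ∈ rotationSet b X, v ≠ 0
    · obtain ⟨v, hv, hv0⟩ := hne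
      obtain ⟨m, mn, -, -, hmn, hvn⟩ := hscale v hv
      have hm0 : m ≠ 0 := by
        rintro rfl
        obtain ⟨w, -, hw⟩ := hlim (Ultrafilter.of atTop) (Ultrafilter.of_le _)
        have h := (hmn.mono_left (Ultrafilter.of_le _)).smul hw
        simp only [← hvn, zero_smul] at h
        exact hv0 (tendsto_nhds_unique tendsto_const_nhds h)
      refine ⟨m⁻¹ • v, ((hmn.inv₀ hm0).smul_const v).congr' ?_⟩
      filter_upwards [hmn.eventually_ne hm0] with n hn
      rw [hvn n, inv_smul_smul₀ hn]
    · push Not at hne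
      refine ⟨0, (tendsto_iff_ultrafilter _ _ _).2 fun U hU => ?_⟩
      obtain ⟨w, hw, h⟩ := hlim U hU
      rwa [hne w hw] at h
  have hζmem : ζ ∈ rotationSet b X := by
    obtain ⟨w, hw, h⟩ := hlim (Ultrafilter.of atTop) (Ultrafilter.of_le _)
    rwa [tendsto_nhds_unique (hζ.mono_left (Ultrafilter.of_le _)) h]
  have hrot : rotationSet b X = segment ℝ 0 ζ := by
    refine Set.Subset.antisymm (fun v hv => ?_) ((convex_rotationSet hX hK hbp).segment_subset
      (zero_mem_rotationSet hX hK hbp hbx₀) hζmem)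
    obtain ⟨m, mn, hm0, hm1, hmn, hvn⟩ := hscale v hv
    have h := hmn.smul hζ
    simp only [← hvn] at h
    rw [tendsto_nhds_unique tendsto_const_nhds h]
    exact ⟨1 - m, m, by linarith, hm0, by ring, by simp⟩
  refine ⟨ζ, hζ, hrot, Set.mem_iUnion.2 ⟨x₀, Tendsto.mapClusterPt ?_⟩,
    mem_limitPointsSet_of_rotationSet_eq_segment hX hK hbp hrot⟩
  have hfix : ∀ t, X t x₀ = x₀ := fun t =>
    (hX.unique hK (γ := fun _ => x₀) (fun t => by
      simpa only [hb, hx₀, zero_smul] using hasDerivAt_const t x₀) t).symm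
  simpa [hfix] using (tendsto_inv_atTop_nhds_zero_nat (𝕜 := ℝ)).smul_const x₀
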